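/- arXiv:1511.03737 — 7 statements merged into one kernel-verified Lean document; each statement's English description precedes it below -/
import Mathlib

section
/- Every natural linear ordering of a finite distributive lattice is a linear extension of the lattice ordering: if ⊑ is a natural linear order on a finite distributive lattice L and x < y in the lattice order of L, then x ⊏ y. -/
open Function

/-- An element of a lattice with least element `⊥` is join-irreducible if it is not `⊥`
and `j = a ⊔ b` implies `j = a` or `j = b`. -/
def JoinIrred {L : Type*} [Lattice L] [OrderBot L] (j : L) : Prop :=
  j ≠ ⊥ ∧ ∀ a b : L, j = a ⊔ b → j = a ∨ j = b

/-- `latN f` is the set `N(f) = {x | ∃ y, y < x ∧ f y = f x}`. -/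
def latN {L K : Type*} [Preorder L] (f : L → K) : Set L :=
  {x | ∃ y, y < x ∧ f y = f x}

open Classical in
/-- `minus x S` is `x − S`: the join of the set of join-irreducibles `j` with
`j ≤ x` and `j ∉ S` (the empty join being `⊥`). -/
noncomputable def minus {L : Type*} [Lattice L] [OrderBot L] [Fintype L]
    (x : L) (S : Set L) : L :=
  (Finset.univ.filter fun j : L => JoinIrred j ∧ j ≤ x ∧ j ∉ S).sup id

/-- A `{0,1}`-lattice homomorphism: a map preserving `⊔`, `⊓`, `⊥` and `⊤`. -/
def IsBddLatticeHom {L K : Type*} [Lattice L] [BoundedOrder L] [Lattice K] [BoundedOrder K]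
    (f : L → K) : Prop :=
  (∀ x y : L, f (x ⊔ y) = f x ⊔ f y) ∧ (∀ x y : L, f (x ⊓ y) = f x ⊓ f y) ∧
    f ⊥ = ⊥ ∧ f ⊤ = ⊤

/-- `r` is a natural linear order on the bounded lattice `L`: it is a (reflexive) linear
order whose restriction to the join-irreducibles extends the lattice order, and which is
the antilexicographic order determined by this restriction: for distinct `x`, `y`,
`x` is strictly below `y` iff the `r`-greatest join-irreducible `j` for which exactly one
of `j ≤ x`, `j ≤ y` holds satisfies `j ≤ y`. -/
def IsNaturalOrder {L : Type*} [Lattice L] [BoundedOrder L] (r : L → L → Prop) : Prop :=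
  IsLinearOrder L r ∧
  (∀ j j' : L, JoinIrred j → JoinIrred j' → j ≤ j' → r j j') ∧
  ∀ x y : L, x ≠ y →
    (r x y ↔ ∃ j : L, JoinIrred j ∧ j ≤ y ∧ ¬ j ≤ x ∧
      ∀ j' : L, JoinIrred j' → ¬ ((j' ≤ x) ↔ (j' ≤ y)) → r j' j)

/-- A homomorphism `f : L → K` between lattices carrying linear orders `rL`, `rK`
is positive if `x − N(f) ⊑ y − N(f)` implies `f x ≼ f y`. -/
def IsPositive {L K : Type*} [Lattice L] [OrderBot L] [Fintype L]
    (rL : L → L → Prop) (rK : K → K → Prop) (f : L → K) : Prop :=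
  ∀ x y : L, rL (minus x (latN f)) (minus y (latN f)) → rK (f x) (f y)

open Classical in
/-- The Birkhoff dual of a `{0,1}`-lattice homomorphism: `J(f)(y) = ⋀ {x | f x ≥ y}`. -/
noncomputable def birkhoffDual {L K : Type*} [Lattice L] [OrderTop L] [Fintype L] [Preorder K]
    (f : L → K) (y : K) : L :=
  (Finset.univ.filter fun x : L => y ≤ f x).inf id

theorem SupIrred.joinIrred {L : Type*} [Lattice L] [OrderBot L] {j : L} (hj : SupIrred j) :
    JoinIrred j :=
  ⟨hj.ne_bot, fun _ _ h => (hj.2 h.symm).imp Eq.symm Eq.symm⟩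

/-- In a finite lattice, join-irreducibles separate elements. -/
theorem exists_joinIrred_le_not_le {L : Type*} [Lattice L] [Finite L] [OrderBot L] {x y : L}
    (h : ¬ y ≤ x) : ∃ j : L, JoinIrred j ∧ j ≤ y ∧ ¬ j ≤ x := by
  obtain ⟨s, rfl, hs⟩ := exists_supIrred_decomposition y
  by_contra! hc
  exact h (Finset.sup_le fun j hj => hc j (hs hj).joinIrred (Finset.le_sup (f := id) hj))

/-- A nonempty finite set has a greatest element for any total transitive relation. -/
theorem Finset.Nonempty.exists_forall_rel {α : Type*} {r : α → α → Prop}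
    [Std.Total r] [IsTrans α r] {s : Finset α} (hs : s.Nonempty) :
    ∃ m ∈ s, ∀ a ∈ s, r a m := by
  induction hs using Finset.Nonempty.cons_induction with
  | singleton a => exact ⟨a, by simp, by simpa using (Std.Total.total (r := r) a a).elim id id⟩
  | cons a s ha hs ih =>
    obtain ⟨m, hm, hmax⟩ := ih
    rcases Std.Total.total (r := r) a m with h | h
    · exact ⟨m, by simp [hm], by simpa using ⟨h, hmax⟩⟩
    · refine ⟨a, by simp, ?_⟩
      simp only [Finset.mem_cons, forall_eq_or_imp]
      exact ⟨(Std.Total.total (r := r) a a).elim id id,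
        fun b hb => _root_.trans (hmax b hb) h⟩

/-- every natural linear order on a finite distributive lattice
extends the lattice order: if `x < y` then `x ⊏ y`. -/
theorem natural_order_extends_lattice_order {L : Type*}
    [DistribLattice L] [Fintype L] [BoundedOrder L]
    (r : L → L → Prop) (hr : IsNaturalOrder r) (x y : L) (hxy : x < y) :
    r x y ∧ x ≠ y := by
  classical
  obtain ⟨hlin, -, hlex⟩ := hr
  refine ⟨(hlex x y hxy.ne).2 ?_, hxy.ne⟩
  obtain ⟨j, hj, hjy, hjx⟩ := exists_joinIrred_le_not_le hxy.not_ge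
  obtain ⟨m, hm, hmax⟩ := Finset.Nonempty.exists_forall_rel (r := r)
    (s := {j : L | JoinIrred j ∧ j ≤ y ∧ ¬ j ≤ x}) ⟨j, by simp [hj, hjy, hjx]⟩
  simp only [Finset.mem_filter, Finset.mem_univ, true_and] at hm hmax
  refine ⟨m, hm.1, hm.2.1, hm.2.2, fun j' hj' hdiff => hmax j' ⟨hj', ?_⟩⟩
  have hle : j' ≤ x → j' ≤ y := fun h => h.trans hxy.le
  tauto
end

section
/- For every {0,1}-lattice homomorphism f : L → K between finite distributive lattices and every x ∈ L, one has f(x) = f(x − N(f)). -/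
open Function

theorem minus_le {L : Type*} [Lattice L] [OrderBot L] [Fintype L] (x : L) (S : Set L) :
    minus x S ≤ x := by
  classical
  exact Finset.sup_le fun j hj => (Finset.mem_filter.1 hj).2.2.1

theorem minus_mono {L : Type*} [Lattice L] [OrderBot L] [Fintype L] (S : Set L) {x y : L}
    (h : x ≤ y) : minus x S ≤ minus y S := by
  classical
  refine Finset.sup_mono fun j hj => ?_
  simp only [Finset.mem_filter, Finset.mem_univ, true_and] at hj ⊢
  exact ⟨hj.1, hj.2.1.trans h, hj.2.2⟩

theorem JoinIrred.le_minus {L : Type*} [Lattice L] [OrderBot L] [Fintype L] {j x : L}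
    {S : Set L} (hj : JoinIrred j) (hx : j ≤ x) (hS : j ∉ S) : j ≤ minus x S := by
  classical
  exact Finset.le_sup (f := id) (Finset.mem_filter.2 ⟨Finset.mem_univ j, hj, hx, hS⟩)

/-- for every `{0,1}`-lattice homomorphism `f : L → K` between finite
distributive lattices and every `x ∈ L`, `f x = f (x − N(f))`. -/
theorem apply_minus_N {L K : Type*}
    [DistribLattice L] [Fintype L] [BoundedOrder L]
    [DistribLattice K] [Fintype K] [BoundedOrder K]
    (f : L → K) (hf : IsBddLatticeHom f) (x : L) :
    f x = f (minus x (latN f)) := by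
  have hmono : Monotone f := fun a b hab => by
    rw [← sup_eq_right, ← hf.1, sup_eq_right.2 hab]
  refine le_antisymm ?_ (hmono (minus_le x _))
  induction x using WellFoundedLT.induction with
  | _ x ih =>
    have step : ∀ y, y < x → f y ≤ f (minus x (latN f)) := fun y hy =>
      (ih y hy).trans (hmono (minus_mono _ hy.le))
    by_cases hN : x ∈ latN f
    · obtain ⟨y, hy, hfy⟩ := hN
      exact hfy ▸ step y hy
    by_cases hx : JoinIrred x
    · exact hmono (hx.le_minus le_rfl hN)
    by_cases hbot : x = ⊥
    · exact hmono (hbot ▸ bot_le)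
    obtain ⟨a, b, hab, ha, hb⟩ : ∃ a b, x = a ⊔ b ∧ x ≠ a ∧ x ≠ b := by
      simpa [JoinIrred, hbot] using hx
    have hfx : f x = f a ⊔ f b := by rw [← hf.1, ← hab]
    rw [hfx]
    exact sup_le (step a (lt_of_le_of_ne (hab ▸ le_sup_left) ha.symm))
      (step b (lt_of_le_of_ne (hab ▸ le_sup_right) hb.symm))
end

section
/- If f : L_⊑ → K_≼ is a positive surjective {0,1}-lattice homomorphism between naturally ordered finite distributive lattices, then its Birkhoff dual J(f) preserves and reflects the linear orders on join-irreducibles: for all join-irreducibles j, j' ∈ J(K), j ≼ j' if and only if J(f)(j) ⊑ J(f)(j'). -/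
open Function

section BirkhoffDual

variable {L K : Type*} [Lattice L] [BoundedOrder L] [Lattice K] [BoundedOrder K] {f : L → K}

theorem IsBddLatticeHom.monotone (hf : IsBddLatticeHom f) : Monotone f := fun x y h => by
  rw [← sup_eq_right, ← hf.1, sup_eq_right.2 h]

variable [Fintype L]

/-- The Birkhoff dual is the lower adjoint of the homomorphism. -/
theorem IsBddLatticeHom.birkhoffDual_gc (hf : IsBddLatticeHom f) :
    GaloisConnection (birkhoffDual f) f := by
  intro y x
  have hy : y ≤ f (birkhoffDual f y) := by
    refine Finset.inf_induction (p := fun x => y ≤ f x) ?_ ?_ ?_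
    · simp [hf.2.2.2]
    · intro a ha b hb
      rw [hf.2.1]
      exact le_inf ha hb
    · simp
  exact ⟨fun h => hy.trans (hf.monotone h), fun h => Finset.inf_le (f := id) (by simpa using h)⟩

theorem IsBddLatticeHom.map_birkhoffDual (hf : IsBddLatticeHom f) (hsurj : Surjective f) (y : K) :
    f (birkhoffDual f y) = y := by
  obtain ⟨x, rfl⟩ := hsurj y
  exact hf.birkhoffDual_gc.u_l_u_eq_u x

theorem JoinIrred.birkhoffDual {j : K} (hj : JoinIrred j) (hf : IsBddLatticeHom f)
    (hsurj : Surjective f) : JoinIrred (birkhoffDual f j) := by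
  have hfj := hf.map_birkhoffDual hsurj j
  refine ⟨fun h => hj.1 ?_, fun a b h => ?_⟩
  · rw [← hfj, h, hf.2.2.1]
  · have hab : j = f a ⊔ f b := by rw [← hf.1, ← h, hfj]
    refine (hj.2 _ _ hab).imp (fun ha => ?_) (fun hb => ?_)
    · exact le_antisymm ((hf.birkhoffDual_gc _ _).2 ha.le) (h ▸ le_sup_left)
    · exact le_antisymm ((hf.birkhoffDual_gc _ _).2 hb.le) (h ▸ le_sup_right)

theorem IsBddLatticeHom.birkhoffDual_notMem_latN (hf : IsBddLatticeHom f) (y : K) :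
    birkhoffDual f y ∉ latN f := by
  rintro ⟨x, hx, hfx⟩
  exact hx.not_ge ((hf.birkhoffDual_gc y x).2 (hfx ▸ hf.birkhoffDual_gc.le_u_l y))

theorem JoinIrred.minus_eq_self {x : L} (hx : JoinIrred x) {S : Set L} (hxS : x ∉ S) :
    minus x S = x := by
  refine le_antisymm (Finset.sup_le ?_) (Finset.le_sup (f := id) ?_)
  · simp +contextual
  · simpa using ⟨hx, hxS⟩

end BirkhoffDual

/-- the Birkhoff dual of a positive surjective homomorphism between
naturally ordered finite distributive lattices preserves and reflects the linear
orders on join-irreducibles. -/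
theorem birkhoffDual_preserves_reflects {L K : Type*}
    [DistribLattice L] [Fintype L] [BoundedOrder L]
    [DistribLattice K] [Fintype K] [BoundedOrder K]
    (rL : L → L → Prop) (rK : K → K → Prop)
    (hL : IsNaturalOrder rL) (hK : IsNaturalOrder rK)
    (f : L → K) (hf : IsBddLatticeHom f) (hsurj : Function.Surjective f)
    (hpos : IsPositive rL rK f)
    (j j' : K) (hj : JoinIrred j) (hj' : JoinIrred j') :
    rK j j' ↔ rL (birkhoffDual f j) (birkhoffDual f j') := by
  have h_reflects : ∀ a b : K, JoinIrred a → JoinIrred b →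
      rL (birkhoffDual f a) (birkhoffDual f b) → rK a b := by
    intro a b ha hb h
    have hab := hpos (birkhoffDual f a) (birkhoffDual f b)
    rw [(ha.birkhoffDual hf hsurj).minus_eq_self (hf.birkhoffDual_notMem_latN a),
      (hb.birkhoffDual hf hsurj).minus_eq_self (hf.birkhoffDual_notMem_latN b),
      hf.map_birkhoffDual hsurj, hf.map_birkhoffDual hsurj] at hab
    exact hab h
  have := hL.1
  have := hK.1
  refine ⟨fun h => ?_, h_reflects j j' hj hj'⟩
  rcases total_of rL (birkhoffDual f j) (birkhoffDual f j') with h' | h'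
  · exact h'
  · rw [antisymm_of rK h (h_reflects j' j hj' hj h')]
    exact refl_of rL _
end

section
/- If φ : P_⊑ → Q_≺ is an embedding of linearly ordered finite posets, then the map O(φ) : O(Q) → O(P), U ↦ φ⁻¹(U), is a surjective {0,1}-lattice homomorphism from the lattice of down-sets of Q onto the lattice of down-sets of P, and it is positive with respect to the natural orders on O(Q) and O(P) induced by ≺ and ⊑ respectively. -/
open Function

/-- The natural (antilexicographic) order induced on down-sets by a linear order `r`:
`U` is below `V` iff `U = V` or the `r`-greatest element of the symmetric difference
of `U` and `V` lies in `V`. -/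
def inducedLowerSetOrder {Q : Type*} [Preorder Q] (r : Q → Q → Prop)
    (U V : LowerSet Q) : Prop :=
  U = V ∨ ∃ a : Q, a ∈ V ∧ a ∉ U ∧ ∀ b : Q, ¬ ((b ∈ U) ↔ (b ∈ V)) → r b a

open Classical in
noncomputable instance {α : Type*} [Fintype α] [PartialOrder α] : Fintype (LowerSet α) :=
  Fintype.ofInjective (fun U : LowerSet α => (U : Set α)) SetLike.coe_injective

/-- `O(φ)`: the preimage map on down-sets induced by a monotone map `φ`. -/
def OMap {P Q : Type*} [Preorder P] [Preorder Q] (φ : P → Q) (hφ : Monotone φ) :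
    LowerSet Q → LowerSet P :=
  fun U => ⟨φ ⁻¹' U, U.lower.preimage hφ⟩

theorem mem_minus_iff {Q : Type*} [PartialOrder Q] [Fintype Q] {U : LowerSet Q}
    {S : Set (LowerSet Q)} {b : Q} :
    b ∈ minus U S ↔ ∃ j : LowerSet Q, JoinIrred j ∧ j ≤ U ∧ j ∉ S ∧ b ∈ j := by
  simp only [minus, Finset.sup_eq_iSup, LowerSet.mem_iSup_iff, Finset.mem_filter,
    Finset.mem_univ, true_and, id, exists_prop, and_assoc]

theorem joinIrred_Iic {Q : Type*} [PartialOrder Q] (q : Q) : JoinIrred (LowerSet.Iic q) := by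
  refine ⟨fun h => ?_, fun A B h => ?_⟩
  · have hq : q ∈ LowerSet.Iic q := LowerSet.mem_Iic_iff.2 le_rfl
    rw [h] at hq
    exact hq
  · have hq : q ∈ A ⊔ B := h ▸ LowerSet.mem_Iic_iff.2 le_rfl
    rcases LowerSet.mem_sup_iff.1 hq with hq | hq
    · exact Or.inl (le_antisymm (LowerSet.Iic_le.2 hq) (h ▸ le_sup_left))
    · exact Or.inr (le_antisymm (LowerSet.Iic_le.2 hq) (h ▸ le_sup_right))

theorem OMap_lowerClosure_image_OMap {P Q : Type*} [Preorder P] [Preorder Q] {φ : P → Q}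
    (hφ : Monotone φ) (U : LowerSet Q) :
    lowerClosure (φ '' OMap φ hφ U) ≤ U ∧
      OMap φ hφ (lowerClosure (φ '' OMap φ hφ U)) = OMap φ hφ U := by
  have hle : lowerClosure (φ '' OMap φ hφ U) ≤ U :=
    lowerClosure_le.2 (Set.image_subset_iff.2 fun _ hp => hp)
  refine ⟨hle, SetLike.ext fun p => ⟨fun hp => hle hp, fun hp => ?_⟩⟩
  exact subset_lowerClosure (Set.mem_image_of_mem φ hp)

/-- `U − N(O(φ))` is the down-closure of the part of `U` in the image of `φ`. -/
theorem mem_minus_latN_OMap_iff {P Q : Type*} [Preorder P] [PartialOrder Q] [Fintype Q]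
    {φ : P → Q} (hφ : Monotone φ) {U : LowerSet Q} {b : Q} :
    b ∈ minus U (latN (OMap φ hφ)) ↔ ∃ p, φ p ∈ U ∧ b ≤ φ p := by
  rw [mem_minus_iff]
  constructor
  · rintro ⟨j, -, hjU, hj, hb⟩
    obtain ⟨hle, heq⟩ := OMap_lowerClosure_image_OMap hφ j
    have hclosure : lowerClosure (φ '' OMap φ hφ j) = j :=
      hle.eq_of_not_lt fun hlt => hj ⟨_, hlt, heq⟩
    rw [← hclosure] at hb
    obtain ⟨_, ⟨p, hp, rfl⟩, hbp⟩ := mem_lowerClosure.1 hb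
    exact ⟨p, hjU hp, hbp⟩
  · rintro ⟨p, hp, hbp⟩
    refine ⟨LowerSet.Iic (φ p), joinIrred_Iic _, LowerSet.Iic_le.2 hp, ?_, hbp⟩
    rintro ⟨V, hlt, heq⟩
    have hpV : p ∈ OMap φ hφ V := by
      rw [heq]
      exact LowerSet.mem_Iic_iff.2 le_rfl
    exact hlt.not_ge (LowerSet.Iic_le.2 hpV)

theorem apply_mem_minus_latN_OMap_iff {P Q : Type*} [Preorder P] [PartialOrder Q] [Fintype Q]
    {φ : P → Q} (hφ : Monotone φ) {U : LowerSet Q} {p : P} :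
    φ p ∈ minus U (latN (OMap φ hφ)) ↔ φ p ∈ U := by
  rw [mem_minus_latN_OMap_iff]
  exact ⟨fun ⟨_, hq, hle⟩ => U.lower hle hq, fun hp => ⟨p, hp, le_rfl⟩⟩

theorem OMap_surjective {P Q : Type*} [Preorder P] [Preorder Q] {φ : P → Q}
    (hφ : Monotone φ) (hord : ∀ x y : P, φ x ≤ φ y → x ≤ y) :
    Function.Surjective (OMap φ hφ) := by
  refine fun W => ⟨lowerClosure (φ '' W), SetLike.ext fun p => ⟨fun hp => ?_, fun hp => ?_⟩⟩
  · obtain ⟨_, ⟨q, hq, rfl⟩, hpq⟩ := mem_lowerClosure.1 hp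
    exact W.lower (hord _ _ hpq) hq
  · exact subset_lowerClosure (Set.mem_image_of_mem φ hp)

theorem isBddLatticeHom_OMap {P Q : Type*} [Preorder P] [Preorder Q] {φ : P → Q}
    (hφ : Monotone φ) : IsBddLatticeHom (OMap φ hφ) :=
  ⟨fun _ _ => rfl, fun _ _ => rfl, rfl, rfl⟩

theorem isPositive_OMap {P Q : Type*} [Preorder P] [PartialOrder Q] [Fintype Q]
    {rP : P → P → Prop} {rQ : Q → Q → Prop} [Std.Antisymm rQ]
    (hextQ : ∀ x y : Q, x ≤ y → rQ x y) {φ : P → Q} (hφ : Monotone φ)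
    (hlin : ∀ x y : P, rQ (φ x) (φ y) → rP x y) :
    IsPositive (inducedLowerSetOrder rQ) (inducedLowerSetOrder rP) (OMap φ hφ) := by
  rintro U V (heq | ⟨a, haV, haU, hmax⟩)
  · left
    ext p
    change φ p ∈ U ↔ φ p ∈ V
    rw [← apply_mem_minus_latN_OMap_iff hφ, heq, apply_mem_minus_latN_OMap_iff]
  · right
    have hmax' (q : P) (hq : ¬ (φ q ∈ U ↔ φ q ∈ V)) : rQ (φ q) a :=
      hmax _ (by rwa [apply_mem_minus_latN_OMap_iff, apply_mem_minus_latN_OMap_iff])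
    obtain ⟨p, hpV, hap⟩ := (mem_minus_latN_OMap_iff hφ).1 haV
    have hpU : φ p ∉ U := fun hpU => haU ((mem_minus_latN_OMap_iff hφ).2 ⟨p, hpU, hap⟩)
    obtain rfl : a = φ p := antisymm_of rQ (hextQ _ _ hap) (hmax' p fun h => hpU (h.2 hpV))
    exact ⟨p, hpV, hpU, fun q hq => hlin _ _ (hmax' q hq)⟩

/-- if `φ : P_⊑ → Q_≺` is an embedding of linearly ordered finite posets,
then `O(φ) : O(Q) → O(P)`, `U ↦ φ⁻¹(U)`, is a surjective `{0,1}`-lattice homomorphism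
which is positive with respect to the natural orders induced by `≺` and `⊑`. -/
theorem OMap_surjective_hom_positive {P Q : Type*}
    [PartialOrder P] [Fintype P] [PartialOrder Q] [Fintype Q]
    (rP : P → P → Prop) (rQ : Q → Q → Prop)
    (hrP : IsLinearOrder P rP) (hextP : ∀ x y : P, x ≤ y → rP x y)
    (hrQ : IsLinearOrder Q rQ) (hextQ : ∀ x y : Q, x ≤ y → rQ x y)
    (φ : P → Q) (hinj : Function.Injective φ)
    (hord : ∀ x y : P, x ≤ y ↔ φ x ≤ φ y)
    (hlin : ∀ x y : P, rP x y ↔ rQ (φ x) (φ y)) :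
    Function.Surjective (OMap φ (fun _ _ h => (hord _ _).1 h)) ∧
    IsBddLatticeHom (OMap φ (fun _ _ h => (hord _ _).1 h)) ∧
    IsPositive (inducedLowerSetOrder rQ) (inducedLowerSetOrder rP)
      (OMap φ (fun _ _ h => (hord _ _).1 h)) := by
  have hφ : Monotone φ := fun x y => (hord x y).1
  exact ⟨OMap_surjective hφ fun x y => (hord x y).2, isBddLatticeHom_OMap hφ,
    isPositive_OMap hextQ hφ fun x y => (hlin x y).2⟩
end

section
/- The composition of positive surjective homomorphisms between naturally ordered finite distributive lattices is a positive surjective homomorphism: if f : L_⊑ → K_≼ and g : K_≼ → M_< are positive surjective {0,1}-lattice homomorphisms between naturally ordered finite distributive lattices, then g ∘ f : L_⊑ → M_< is a positive surjective {0,1}-lattice homomorphism. -/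
open Function

namespace IsBddLatticeHom

section Monotone

variable {L K M : Type*} [Lattice L] [BoundedOrder L] [Lattice K] [BoundedOrder K]
  [Lattice M] [BoundedOrder M]

theorem comp {g : K → M} {f : L → K} (hg : IsBddLatticeHom g) (hf : IsBddLatticeHom f) :
    IsBddLatticeHom (g ∘ f) := by
  obtain ⟨f1, f2, f3, f4⟩ := hf
  obtain ⟨g1, g2, g3, g4⟩ := hg
  exact ⟨fun x y => by simp [f1, g1], fun x y => by simp [f2, g2], by simp [f3, g3],
    by simp [f4, g4]⟩

theorem monotone_s7 {f : L → K} (hf : IsBddLatticeHom f) : Monotone f := fun x y h => by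
  rw [← sup_eq_right, ← hf.1, sup_eq_right.2 h]

end Monotone

variable {L K M : Type*} [Lattice L] [Fintype L] [BoundedOrder L]
  [Lattice K] [BoundedOrder K] [Lattice M] [BoundedOrder M]

/-- The Birkhoff dual of `f` is the lower adjoint of `f`. -/
theorem gc_birkhoffDual {f : L → K} (hf : IsBddLatticeHom f) :
    GaloisConnection (birkhoffDual f) f := by
  classical
  intro y x
  constructor
  · intro h
    refine le_trans ?_ (hf.monotone_s7 h)
    unfold birkhoffDual
    rw [Finset.apply_inf_eq_inf_comp f hf.2.1 hf.2.2.2]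
    exact Finset.le_inf fun z hz => (Finset.mem_filter.1 hz).2
  · intro h
    exact Finset.inf_le (f := id) (Finset.mem_filter.2 ⟨Finset.mem_univ x, h⟩)

theorem apply_birkhoffDual {f : L → K} (hf : IsBddLatticeHom f) (hfs : Surjective f) (y : K) :
    f (birkhoffDual f y) = y := by
  obtain ⟨x, rfl⟩ := hfs y
  exact hf.gc_birkhoffDual.u_l_u_eq_u x

theorem birkhoffDual_comp [Fintype K] {g : K → M} {f : L → K} (hg : IsBddLatticeHom g)
    (hf : IsBddLatticeHom f) (y : M) :
    birkhoffDual (g ∘ f) y = birkhoffDual f (birkhoffDual g y) :=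
  (hg.comp hf).gc_birkhoffDual.l_unique (hg.gc_birkhoffDual.compose hf.gc_birkhoffDual)
    fun _ => rfl

theorem joinIrred_birkhoffDual {f : L → K} (hf : IsBddLatticeHom f) (hfs : Surjective f)
    {y : K} (hy : JoinIrred y) : JoinIrred (birkhoffDual f y) := by
  have key : ∀ a, a ≤ birkhoffDual f y → y = f a → birkhoffDual f y = a := fun a ha h =>
    le_antisymm ((hf.gc_birkhoffDual _ _).2 h.le) ha
  refine ⟨fun h => hy.1 ?_, fun a b h => ?_⟩
  · rw [← hf.apply_birkhoffDual hfs y, h, hf.2.2.1]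
  · refine (hy.2 (f a) (f b) ?_).imp (key a (h ▸ le_sup_left)) (key b (h ▸ le_sup_right))
    rw [← hf.1, ← h, hf.apply_birkhoffDual hfs]

theorem birkhoffDual_notMem_latN_s7 {f : L → K} (hf : IsBddLatticeHom f) (hfs : Surjective f)
    (y : K) : birkhoffDual f y ∉ latN f := by
  rintro ⟨z, hz, h⟩
  rw [hf.apply_birkhoffDual hfs] at h
  exact hz.not_ge ((hf.gc_birkhoffDual _ _).2 h.ge)

theorem birkhoffDual_apply_of_notMem_latN {f : L → K} (hf : IsBddLatticeHom f) {x : L}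
    (hx : x ∉ latN f) : birkhoffDual f (f x) = x := by
  by_contra h
  exact hx ⟨_, (hf.gc_birkhoffDual.l_u_le x).lt_of_ne h, hf.gc_birkhoffDual.u_l_u_eq_u x⟩

theorem minus_latN [Fintype K] {f : L → K} (hf : IsBddLatticeHom f) (hfs : Surjective f)
    (x : L) : minus x (latN f) = birkhoffDual f (f x) := by
  classical
  have gc := hf.gc_birkhoffDual
  apply le_antisymm
  · refine Finset.sup_le fun j hj => ?_
    obtain ⟨-, -, hjx, hjN⟩ := Finset.mem_filter.1 hj
    rw [id, ← hf.birkhoffDual_apply_of_notMem_latN hjN]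
    exact gc.monotone_l (hf.monotone_s7 hjx)
  · obtain ⟨s, hs, hirr⟩ := exists_supIrred_decomposition (f x)
    rw [gc, ← hs]
    refine Finset.sup_le fun y hy => (gc _ _).1 ?_
    refine Finset.le_sup (f := id) (Finset.mem_filter.2 ⟨Finset.mem_univ _,
      hf.joinIrred_birkhoffDual hfs (hirr hy).joinIrred, ?_,
      hf.birkhoffDual_notMem_latN_s7 hfs y⟩)
    exact (gc _ _).2 (hs ▸ Finset.le_sup (f := id) hy)

/-- A surjective homomorphism is positive iff its Birkhoff dual reflects the linear orders. -/
theorem isPositive_iff [Fintype K] {f : L → K} (hf : IsBddLatticeHom f) (hfs : Surjective f)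
    (rL : L → L → Prop) (rK : K → K → Prop) :
    IsPositive rL rK f ↔ ∀ a b, rL (birkhoffDual f a) (birkhoffDual f b) → rK a b := by
  simp only [IsPositive, hf.minus_latN hfs, hfs.forall]

end IsBddLatticeHom

/-- the composition of positive surjective `{0,1}`-lattice homomorphisms
between naturally ordered finite distributive lattices is a positive surjective
`{0,1}`-lattice homomorphism. -/
theorem comp_positive_surjective {L K M : Type*}
    [DistribLattice L] [Fintype L] [BoundedOrder L]
    [DistribLattice K] [Fintype K] [BoundedOrder K]
    [DistribLattice M] [Fintype M] [BoundedOrder M]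
    (rL : L → L → Prop) (rK : K → K → Prop) (rM : M → M → Prop)
    (hL : IsNaturalOrder rL) (hK : IsNaturalOrder rK) (hM : IsNaturalOrder rM)
    (f : L → K) (hf : IsBddLatticeHom f) (hfs : Function.Surjective f)
    (hfpos : IsPositive rL rK f)
    (g : K → M) (hg : IsBddLatticeHom g) (hgs : Function.Surjective g)
    (hgpos : IsPositive rK rM g) :
    IsBddLatticeHom (g ∘ f) ∧ Function.Surjective (g ∘ f) ∧ IsPositive rL rM (g ∘ f) := by
  refine ⟨hg.comp hf, hgs.comp hfs, ?_⟩
  rw [(hg.comp hf).isPositive_iff (hgs.comp hfs)]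
  rw [hf.isPositive_iff hfs] at hfpos
  rw [hg.isPositive_iff hgs] at hgpos
  intro a b h
  rw [hg.birkhoffDual_comp hf, hg.birkhoffDual_comp hf] at h
  exact hgpos a b (hfpos _ _ h)
end

section
/- The kernel of a positive homomorphism is a positive congruence: if f : L_⊑ → K_≼ is a positive surjective {0,1}-lattice homomorphism between naturally ordered finite distributive lattices, then for all a, b ∈ L with f(a) ≠ f(b), either c − N(f) ⊑ d − N(f) for all c, d ∈ L with f(c) = f(a) and f(d) = f(b), or d − N(f) ⊑ c − N(f) for all such c, d. -/
open Function

/-- The kernel of `f` is a positive congruence: any two distinct kernel classes are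
uniformly comparable via `· − N(f)` in the order `rL`. -/
def KernelPositive {L K : Type*} [Lattice L] [OrderBot L] [Fintype L]
    (rL : L → L → Prop) (f : L → K) : Prop :=
  ∀ a b : L, f a ≠ f b →
    (∀ c d : L, f c = f a → f d = f b → rL (minus c (latN f)) (minus d (latN f))) ∨
    (∀ c d : L, f c = f a → f d = f b → rL (minus d (latN f)) (minus c (latN f)))

/-- the kernel of a positive surjective homomorphism between naturally
ordered finite distributive lattices is a positive congruence. -/
theorem kernel_of_positive_is_positive {L K : Type*}
    [DistribLattice L] [Fintype L] [BoundedOrder L]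
    [DistribLattice K] [Fintype K] [BoundedOrder K]
    (rL : L → L → Prop) (rK : K → K → Prop)
    (hL : IsNaturalOrder rL) (hK : IsNaturalOrder rK)
    (f : L → K) (hf : IsBddLatticeHom f) (hsurj : Function.Surjective f)
    (hpos : IsPositive rL rK f) :
    KernelPositive rL f := by
  have := hL.1
  have := hK.1
  have key : ∀ a b : L, f a ≠ f b → rK (f a) (f b) →
      ∀ c d : L, f c = f a → f d = f b → rL (minus c (latN f)) (minus d (latN f)) := by
    intro a b hab h c d hc hd
    refine (total_of rL _ _).resolve_right fun hdc => hab (antisymm_of rK h ?_)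
    rw [← hc, ← hd]
    exact hpos d c hdc
  intro a b hab
  rcases total_of rK (f a) (f b) with h | h
  · exact Or.inl (key a b hab h)
  · exact Or.inr fun c d hc hd => key b a hab.symm h d c hd hc
end

section
/- For every linearly ordered finite poset Q_⊑, the map x ↦ ↓x (the principal down-set of x) is a bijection from Q onto the set of join-irreducible elements of the down-set lattice O(Q), and for all x, y ∈ Q: x ≤ y if and only if ↓x ⊆ ↓y, and x ⊑ y if and only if ↓x is below ↓y in the natural order on O(Q) induced by ⊑. -/
open Function

theorem joinIrred_iff_supIrred {L : Type*} [Lattice L] [OrderBot L] {j : L} :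
    JoinIrred j ↔ SupIrred j := by
  simp only [JoinIrred, SupIrred, isMin_iff_eq_bot, ne_eq, eq_comm (a := j)]

/-- for a linearly ordered finite poset `Q_⊑`, the map `x ↦ ↓x` is a
bijection from `Q` onto the join-irreducible elements of the down-set lattice `O(Q)`;
moreover `x ≤ y` iff `↓x ⊆ ↓y`, and `x ⊑ y` iff `↓x` is below `↓y` in the natural
order on `O(Q)` induced by `⊑`. -/
theorem principal_downset_bijection {Q : Type*} [PartialOrder Q] [Fintype Q]
    (r : Q → Q → Prop) (hr : IsLinearOrder Q r) (hext : ∀ x y : Q, x ≤ y → r x y) :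
    (∀ x : Q, JoinIrred (LowerSet.Iic x)) ∧
    Function.Injective (fun x : Q => LowerSet.Iic x) ∧
    (∀ U : LowerSet Q, JoinIrred U → ∃ x : Q, LowerSet.Iic x = U) ∧
    (∀ x y : Q, x ≤ y ↔ LowerSet.Iic x ≤ LowerSet.Iic y) ∧
    (∀ x y : Q, r x y ↔ inducedLowerSetOrder r (LowerSet.Iic x) (LowerSet.Iic y)) := by
  have := hr
  refine ⟨fun x ↦ joinIrred_iff_supIrred.2 (LowerSet.supIrred_Iic x), LowerSet.Iic_injective,
    fun U hU ↦ LowerSet.supIrred_iff_of_finite.1 (joinIrred_iff_supIrred.1 hU),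
    fun x y ↦ (LowerSet.Iic_le (s := LowerSet.Iic y)).symm, fun x y ↦ ⟨fun hxy ↦ ?_, ?_⟩⟩
  · by_cases hne : x = y
    · exact Or.inl (congrArg _ hne)
    · refine Or.inr ⟨y, le_rfl, fun hyx ↦ hne (antisymm_of r hxy (hext _ _ hyx)), fun b hb ↦ ?_⟩
      by_cases hbx : b ≤ x
      · exact trans_of r (hext _ _ hbx) hxy
      · by_cases hby : b ≤ y
        · exact hext _ _ hby
        · exact absurd (iff_of_false hbx hby) hb
  · rintro (h | ⟨a, hay, -, hmax⟩)
    · exact hext _ _ (LowerSet.Iic_injective h).le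
    · by_cases hxy : x ≤ y
      · exact hext _ _ hxy
      · exact trans_of r (hmax x fun h ↦ hxy (h.1 le_rfl)) (hext _ _ hay)
end
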